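/- Let A_0, A_1, A_2, A_3, A_4 be a skew-symmetric association scheme on a finite nonempty set X with |X| = n, with primitive idempotents ordered as described. If its character table is of type 3, then each of the matrices A_1, A_2, A_3 and A_4 has exactly 5 distinct eigenvalues. -/

import Mathlib

open Matrix Polynomial

def IsZeroOne {X : Type*} (A : Matrix X X ℂ) : Prop :=
  ∀ i j, A i j = 0 ∨ A i j = 1

def IsAssocScheme {X : Type*} [Fintype X] [DecidableEq X] {d : ℕ}
    (A : Fin (d+1) → Matrix X X ℂ) : Prop :=
  (∀ i, A i ≠ 0) ∧
  (∀ i, IsZeroOne (A i)) ∧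
  A 0 = 1 ∧
  (∑ i, A i) = Matrix.of (fun _ _ => (1:ℂ)) ∧
  (∀ i, ∃ i', (A i)ᵀ = A i') ∧
  (∀ i j, A i * A j = A j * A i) ∧
  (∀ i j, ∃ p : Fin (d+1) → ℕ, A i * A j = ∑ l, (p l : ℂ) • A l)

def Generates {X : Type*} [Fintype X] [DecidableEq X] {d : ℕ}
    (A : Fin (d+1) → Matrix X X ℂ) (B : Matrix X X ℂ) : Prop :=
  ∀ C ∈ Submodule.span ℂ (Set.range A), ∃ q : Polynomial ℂ, C = Polynomial.aeval B q

noncomputable def numDistinctEigen {X : Type*} [Fintype X] [DecidableEq X]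
    (B : Matrix X X ℂ) : ℕ :=
  B.charpoly.roots.toFinset.card

def ArePrimIdem {X : Type*} [Fintype X] [DecidableEq X] {d : ℕ}
    (A E : Fin (d+1) → Matrix X X ℂ) : Prop :=
  (∀ i, E i ∈ Submodule.span ℂ (Set.range A)) ∧
  E 0 = ((Fintype.card X : ℂ))⁻¹ • Matrix.of (fun _ _ => (1:ℂ)) ∧
  (∀ i j, E i * E j = if i = j then E i else 0) ∧
  (∑ i, E i) = 1 ∧
  (∀ i j, ∃ p : ℂ, A i * E j = p • E j)

def IsAmorphic {X : Type*} [Fintype X] [DecidableEq X] {d : ℕ}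
    (A : Fin (d+1) → Matrix X X ℂ) : Prop :=
  ∀ (e : ℕ) (Λ : Fin (e+1) → Finset (Fin (d+1))),
    Λ 0 = {0} →
    (∀ i, (Λ i).Nonempty) →
    (∀ i j, i ≠ j → Disjoint (Λ i) (Λ j)) →
    (∀ m, ∃ i, m ∈ Λ i) →
    ∀ i j, ∃ p : Fin (e+1) → ℕ,
      (∑ α ∈ Λ i, A α) * (∑ β ∈ Λ j, A β) = ∑ l, (p l : ℂ) • (∑ α ∈ Λ l, A α)

def HasForm12 {X : Type*} [Fintype X] [DecidableEq X] {d : ℕ}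
    (A E : Fin (d+1) → Matrix X X ℂ) (k a b : Fin (d+1) → ℂ) : Prop :=
  ∀ i : Fin (d+1), i ≠ 0 →
    A i * E 0 = k i • E 0 ∧
    A i * E i = b i • E i ∧
    (∀ j : Fin (d+1), j ≠ 0 → j ≠ i → A i * E j = a i • E j) ∧
    a i ≠ b i

def symmetrization {X : Type*} {d : ℕ} (A : Fin (d+2) → Matrix X X ℂ) :
    Fin (d+1) → Matrix X X ℂ :=
  fun i => if i = Fin.last d then A i.castSucc + A (Fin.last (d+1)) else A i.castSucc

def IsSRGGraph {V : Type*} (H : SimpleGraph V) (n k l m : ℕ) : Prop :=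
  Nat.card V = n ∧
  (∀ v, (H.neighborSet v).ncard = k) ∧
  (∃ v w, H.Adj v w) ∧
  (∃ v w, v ≠ w ∧ ¬ H.Adj v w) ∧
  (∀ v w, H.Adj v w → ((H.neighborSet v) ∩ (H.neighborSet w)).ncard = l) ∧
  (∀ v w, v ≠ w → ¬ H.Adj v w → ((H.neighborSet v) ∩ (H.neighborSet w)).ncard = m)

open Classical in
noncomputable def graphEigSet {V : Type*} [Fintype V] (H : SimpleGraph V) : Set ℂ :=
  ((Matrix.of (fun x y : V => if H.Adj x y then (1:ℂ) else 0)).charpoly.roots.toFinset : Set ℂ)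

open Classical in
def IsDisjointUnionSRGs {V : Type*} [Fintype V] (G : SimpleGraph V)
    (N w k : ℕ) (r s : ℂ) : Prop :=
  Nat.card G.ConnectedComponent = N ∧
  r ≠ (k : ℂ) ∧ s ≠ (k : ℂ) ∧
  ∀ c : G.ConnectedComponent,
    c.supp.ncard = w ∧
    (G.induce c.supp).Connected ∧
    (∃ l m : ℕ, IsSRGGraph (G.induce c.supp) w k l m) ∧
    graphEigSet (G.induce c.supp) = {(k : ℂ), r, s}


lemma eig_count {X : Type*} [Fintype X] [DecidableEq X] (B : Matrix X X ℂ)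
    (E : Fin 5 → Matrix X X ℂ) (hs : (∑ i, E i) = 1) (hne : ∀ i, E i ≠ 0)
    (ev : Fin 5 → ℂ) (hev : ∀ j, B * E j = ev j • E j) (hinj : Function.Injective ev) :
    numDistinctEigen B = 5 := by
  have key : B.charpoly.roots.toFinset = Finset.univ.image ev := by
    ext μ
    rw [Multiset.mem_toFinset, Polynomial.mem_roots (Matrix.charpoly_monic B).ne_zero,
      Polynomial.IsRoot, Matrix.eval_charpoly]
    simp only [Finset.mem_image, Finset.mem_univ, true_and]
    constructor
    · intro h
      by_contra hcon
      push Not at hcon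
      obtain ⟨v, hv0, hv⟩ := Matrix.exists_vecMul_eq_zero_iff.mpr h
      apply hv0
      have h1 : ∀ j, v ᵥ* E j = 0 := by
        intro j
        have h2 : (Matrix.scalar X μ - B) * E j = (μ - ev j) • E j := by
          rw [sub_mul, hev j, sub_smul]
          congr 1
          ext a b
          simp [Matrix.scalar_apply]
        have h3 : v ᵥ* ((Matrix.scalar X μ - B) * E j) = 0 := by
          rw [← Matrix.vecMul_vecMul, hv, Matrix.zero_vecMul]
        rw [h2, Matrix.vecMul_smul] at h3
        rcases smul_eq_zero.mp h3 with h4 | h4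
        · exact absurd (sub_eq_zero.mp h4).symm (hcon j)
        · exact h4
      rw [← Matrix.vecMul_one v, ← hs, Fin.sum_univ_five]
      simp [Matrix.vecMul_add, h1]
    · rintro ⟨j, rfl⟩
      by_contra hd
      have hu : IsUnit (Matrix.scalar X (ev j) - B) :=
        (Matrix.isUnit_iff_isUnit_det _).mpr (isUnit_iff_ne_zero.mpr hd)
      have h2 : (Matrix.scalar X (ev j) - B) * E j = 0 := by
        rw [sub_mul, hev j, sub_eq_zero]
        ext a b
        simp [Matrix.scalar_apply]
      exact hne j ((hu.mul_right_eq_zero).mp h2)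
  rw [numDistinctEigen, key, Finset.card_image_of_injective _ hinj]
  simp

lemma zo_star {X : Type*} (B : Matrix X X ℂ) (hB : IsZeroOne B) : Bᴴ = Bᵀ := by
  ext a b
  rcases hB b a with h | h <;> simp [Matrix.conjTranspose_apply, h]

lemma conj_eig {X : Type*} [Fintype X] [DecidableEq X] (B F : Matrix X X ℂ)
    (hB : IsZeroOne B) (p q : ℂ) (h1 : B * F = p • F) (h2 : Bᵀ * F = q • F) (hF : F ≠ 0) :
    q = (starRingEnd ℂ) p := by
  have e1 : Fᴴ * (Bᵀ * F) = (starRingEnd ℂ) p • (Fᴴ * F) := by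
    rw [← zo_star B hB, ← Matrix.mul_assoc, ← Matrix.conjTranspose_mul, h1,
      Matrix.conjTranspose_smul, Matrix.smul_mul]
    rfl
  rw [h2, Matrix.mul_smul] at e1
  have h0 : Fᴴ * F ≠ 0 := by
    open scoped ComplexOrder in
    rwa [Ne, Matrix.conjTranspose_mul_self_eq_zero]
  exact smul_left_injective ℂ h0 e1

lemma core {X : Type*} [Fintype X] [DecidableEq X] [Nonempty X]
    (B : Matrix X X ℂ) (E : Fin 5 → Matrix X X ℂ) (hB : IsZeroOne B)
    (hs : (∑ i, E i) = 1) (hne : ∀ i, E i ≠ 0)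
    (hE0 : E 0 = ((Fintype.card X : ℂ))⁻¹ • Matrix.of (fun _ _ => (1:ℂ)))
    (h0 : ∃ p : ℂ, B * E 0 = p • E 0)
    (ht : ∀ j, ∃ p : ℂ, Bᵀ * E j = p • E j)
    (ρ σ : ℂ) (hρ : ρ.im ≠ 0) (hσ : σ.im ≠ 0)
    (h1 : B * E 1 = ρ • E 1) (h2 : B * E 2 = (starRingEnd ℂ) ρ • E 2)
    (h3 : B * E 3 = σ • E 3) (h4 : B * E 4 = (starRingEnd ℂ) σ • E 4)
    (x y u v : X) (hxy : x ≠ y) (huv : u ≠ v)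
    (hd : (B + Bᵀ) x y ≠ (B + Bᵀ) u v) :
    numDistinctEigen B = 5 := by
  obtain ⟨p, hp⟩ := h0
  have hpim : p.im = 0 := by
    have e := congrArg (fun M : Matrix X X ℂ => M x y) hp
    simp only [hE0, Matrix.smul_apply, Matrix.mul_apply, Matrix.of_apply,
      mul_one, smul_eq_mul] at e
    have hn : ((Fintype.card X : ℂ)) ≠ 0 := by
      exact_mod_cast Fintype.card_ne_zero
    have e2 : p = ∑ j, B x j := by
      rw [← Finset.sum_mul] at e
      exact (mul_right_cancel₀ (inv_ne_zero hn) e).symm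
    rw [e2, Complex.im_sum]
    apply Finset.sum_eq_zero
    intro j _
    rcases hB x j with h | h <;> simp [h]
  have hre : ρ.re ≠ σ.re := by
    intro hre
    have tr : ∀ (j : Fin 5) (q : ℂ), B * E j = q • E j → (B + Bᵀ) * E j = ((2 * q.re : ℝ) : ℂ) • E j := by
      intro j q hq
      obtain ⟨q', hq'⟩ := ht j
      have := conj_eig B (E j) hB q q' hq hq' (hne j)
      rw [add_mul, hq, hq', ← add_smul, this, Complex.add_conj]
    have t0 := tr 0 _ hp
    have t1 := tr 1 _ h1
    have t2 := tr 2 _ h2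
    have t3 := tr 3 _ h3
    have t4 := tr 4 _ h4
    rw [Complex.conj_re] at t2 t4
    rw [← hre] at t3 t4
    have hs' := hs
    rw [Fin.sum_univ_five] at hs'
    have hC : B + Bᵀ = ((2 * p.re : ℝ) : ℂ) • E 0 + ((2 * ρ.re : ℝ) : ℂ) • (1 - E 0) := by
      have e : (1 : Matrix X X ℂ) - E 0 = E 1 + E 2 + E 3 + E 4 := by
        rw [← hs']; abel
      rw [e]
      calc B + Bᵀ = (B + Bᵀ) * 1 := by rw [mul_one]
        _ = _ := by
          rw [← hs']
          simp only [mul_add, t0, t1, t2, t3, t4, smul_add]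
          abel
    apply hd
    rw [hC, hE0]
    simp [Matrix.one_apply_ne hxy, Matrix.one_apply_ne huv]
  refine eig_count B E hs hne ![p, ρ, (starRingEnd ℂ) ρ, σ, (starRingEnd ℂ) σ] ?_ ?_
  · intro j
    fin_cases j
    · exact hp
    · exact h1
    · exact h2
    · exact h3
    · exact h4
  · have a1 : p ≠ ρ := fun h => hρ (by rw [← h]; exact hpim)
    have a2 : p ≠ (starRingEnd ℂ) ρ := fun h => hρ (by
      have := congrArg Complex.im h; simp at this; linarith)
    have a3 : p ≠ σ := fun h => hσ (by rw [← h]; exact hpim)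
    have a4 : p ≠ (starRingEnd ℂ) σ := fun h => hσ (by
      have := congrArg Complex.im h; simp at this; linarith)
    have a5 : ρ ≠ (starRingEnd ℂ) ρ := fun h => hρ (by
      have := congrArg Complex.im h; simp at this; linarith)
    have a6 : σ ≠ (starRingEnd ℂ) σ := fun h => hσ (by
      have := congrArg Complex.im h; simp at this; linarith)
    have a7 : ρ ≠ σ := fun h => hre (by rw [h])
    have a8 : ρ ≠ (starRingEnd ℂ) σ := fun h => hre (by rw [h, Complex.conj_re])
    have a9 : (starRingEnd ℂ) ρ ≠ σ := fun h => hre (by rw [← h, Complex.conj_re])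
    have a10 : (starRingEnd ℂ) ρ ≠ (starRingEnd ℂ) σ := fun h => hre (by
      have := congrArg Complex.re h; simpa using this)
    intro i j hij
    fin_cases i <;> fin_cases j <;> first
      | rfl
      | (exfalso; first
          | exact a1 hij | exact a2 hij | exact a3 hij | exact a4 hij | exact a5 hij
          | exact a6 hij | exact a7 hij | exact a8 hij | exact a9 hij | exact a10 hij
          | exact a1 hij.symm | exact a2 hij.symm | exact a3 hij.symm | exact a4 hij.symm
          | exact a5 hij.symm | exact a6 hij.symm | exact a7 hij.symm | exact a8 hij.symm
          | exact a9 hij.symm | exact a10 hij.symm)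

lemma scheme_disj {X : Type*} [Fintype X] [DecidableEq X]
    (A : Fin 5 → Matrix X X ℂ) (hA : IsAssocScheme A) (i l : Fin 5) (hl : l ≠ i) (x y : X)
    (h : A i x y = 1) : A l x y = 0 := by
  obtain ⟨-, hz, -, hJ, -⟩ := hA
  have e := congrArg (fun M : Matrix X X ℂ => (M x y).re) hJ
  simp only [Matrix.sum_apply, Matrix.of_apply, Complex.re_sum, Complex.one_re] at e
  have nn : ∀ j ∈ Finset.univ, 0 ≤ (A j x y).re := by
    intro j _
    rcases hz j x y with h | h <;> simp [h]
  have := Finset.add_le_sum nn (Finset.mem_univ i) (Finset.mem_univ l) hl.symm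
  rw [e, h] at this
  rcases hz l x y with h' | h'
  · exact h'
  · rw [h'] at this; norm_num at this

lemma scheme_entry {X : Type*} [Fintype X] [DecidableEq X]
    (A : Fin 5 → Matrix X X ℂ) (hA : IsAssocScheme A) (i : Fin 5) :
    ∃ x y, A i x y = 1 := by
  by_contra hcon
  push Not at hcon
  apply hA.1 i
  ext a b
  exact (hA.2.1 i a b).resolve_right (hcon a b)

lemma idem_ne {X : Type*} [Fintype X] [DecidableEq X]
    (A E : Fin 5 → Matrix X X ℂ) (hA : IsAssocScheme A) (hE : ArePrimIdem A E) (j : Fin 5) :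
    E j ≠ 0 := by
  have hLI : LinearIndependent ℂ A := by
    rw [Fintype.linearIndependent_iff]
    intro g hg i
    obtain ⟨x, y, hxy⟩ := scheme_entry A hA i
    have e := congrArg (fun M : Matrix X X ℂ => M x y) hg
    simp only [Matrix.sum_apply, Matrix.smul_apply, smul_eq_mul, Matrix.zero_apply] at e
    rw [Finset.sum_eq_single i] at e
    · simpa [hxy] using e
    · intro l _ hl
      rw [scheme_disj A hA i l hl x y hxy, mul_zero]
    · simp
  have hle : Submodule.span ℂ (Set.range A) ≤ Submodule.span ℂ (Set.range E) := by
    rw [Submodule.span_le]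
    rintro _ ⟨i, rfl⟩
    have e : A i = ∑ l, A i * E l := by rw [← Finset.mul_sum, hE.2.2.2.1, mul_one]
    rw [e]
    refine Submodule.sum_mem _ fun l _ => ?_
    obtain ⟨p, hp⟩ := hE.2.2.2.2 i l
    rw [hp]
    exact Submodule.smul_mem _ _ (Submodule.subset_span ⟨l, rfl⟩)
  have hEI : LinearIndependent ℂ E := by
    rw [linearIndependent_iff_card_le_finrank_span]
    rw [linearIndependent_iff_card_le_finrank_span] at hLI
    exact hLI.trans (Submodule.finrank_mono hle)
  exact hEI.ne_zero j

theorem stmt14 {X : Type*} [Fintype X] [DecidableEq X] [Nonempty X]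
    (A E : Fin 5 → Matrix X X ℂ)
    (hA : IsAssocScheme A)
    (h12 : (A 1)ᵀ = A 2) (h34 : (A 3)ᵀ = A 4)
    (hE : ArePrimIdem A E)
    (k1 k2 m1 m2 : ℝ)
    (hk1 : ∀ x : X, ∑ y : X, (A 1 + A 2) x y = (k1 : ℂ))
    (hk2 : ∀ x : X, ∑ y : X, (A 3 + A 4) x y = (k2 : ℂ))
    (hm1 : (E 1).trace = ((m1 / 2 : ℝ) : ℂ) ∧ (E 2).trace = ((m1 / 2 : ℝ) : ℂ))
    (hm2 : (E 3).trace = ((m2 / 2 : ℝ) : ℂ) ∧ (E 4).trace = ((m2 / 2 : ℝ) : ℂ))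
    (ρ σ τ ω : ℂ)
    (hρ1 : A 1 * E 1 = ρ • E 1) (hρ2 : A 1 * E 2 = (starRingEnd ℂ) ρ • E 2)
    (hσ1 : A 1 * E 3 = σ • E 3) (hσ2 : A 1 * E 4 = (starRingEnd ℂ) σ • E 4)
    (hτ1 : A 3 * E 1 = τ • E 1) (hτ2 : A 3 * E 2 = (starRingEnd ℂ) τ • E 2)
    (hω1 : A 3 * E 3 = ω • E 3) (hω2 : A 3 * E 4 = (starRingEnd ℂ) ω • E 4)
    (htype : ∃ r1 r2 t1 t2 b c y z : ℝ,
      0 < b ∧ 0 < c ∧ 0 < y ∧ 0 < z ∧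
      ρ = ((r1 : ℂ) + Complex.I * ((Real.sqrt y : ℝ) : ℂ)) / 2 ∧
      τ = ((t1 : ℂ) + Complex.I * ((Real.sqrt z : ℝ) : ℂ)) / 2 ∧
      σ = ((r2 : ℂ) + Complex.I * ((Real.sqrt b : ℝ) : ℂ)) / 2 ∧
      ω = ((t2 : ℂ) - Complex.I * ((Real.sqrt c : ℝ) : ℂ)) / 2) :
    numDistinctEigen (A 1) = 5 ∧ numDistinctEigen (A 2) = 5 ∧
    numDistinctEigen (A 3) = 5 ∧ numDistinctEigen (A 4) = 5 := by
  have hne := idem_ne A E hA hE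
  have hz := hA.2.1
  obtain ⟨x, y, hxy⟩ := scheme_entry A hA 1
  obtain ⟨u, v, huv⟩ := scheme_entry A hA 3
  have off : ∀ i : Fin 5, i ≠ 0 → ∀ x y, A i x y = 1 → x ≠ y := by
    rintro i hi x _ h rfl
    have := scheme_disj A hA i 0 hi.symm x x h
    rw [hA.2.2.1] at this
    simp at this
  have nxy := off 1 (by decide) x y hxy
  have nuv := off 3 (by decide) u v huv
  have a2 := scheme_disj A hA 1 2 (by decide) x y hxy
  have a3 := scheme_disj A hA 1 3 (by decide) x y hxy
  have a4 := scheme_disj A hA 1 4 (by decide) x y hxy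
  have b1 := scheme_disj A hA 3 1 (by decide) u v huv
  have b2 := scheme_disj A hA 3 2 (by decide) u v huv
  have b4 := scheme_disj A hA 3 4 (by decide) u v huv
  have h21 : (A 2)ᵀ = A 1 := by rw [← h12, Matrix.transpose_transpose]
  have h43 : (A 4)ᵀ = A 3 := by rw [← h34, Matrix.transpose_transpose]
  have cj : ∀ i i' j q, (A i)ᵀ = A i' → A i * E j = q • E j →
      A i' * E j = (starRingEnd ℂ) q • E j := by
    intro i i' j q hii hq
    obtain ⟨q', hq'⟩ := hE.2.2.2.2 i' j
    rw [hq', conj_eig (A i) (E j) (hz i) q q' hq (by rw [hii, hq']) (hne j)]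
  obtain ⟨r1, r2, t1, t2, b, c, y', z, hb, hc, hy, hz', eρ, eτ, eσ, eω⟩ := htype
  have sb := Real.sqrt_pos.mpr hb
  have sc := Real.sqrt_pos.mpr hc
  have sy := Real.sqrt_pos.mpr hy
  have sz := Real.sqrt_pos.mpr hz'
  have iρ : ρ.im ≠ 0 := by rw [eρ]; simp; exact sy.ne'
  have iτ : τ.im ≠ 0 := by rw [eτ]; simp; exact sz.ne'
  have iσ : σ.im ≠ 0 := by rw [eσ]; simp; exact sb.ne'
  have iω : ω.im ≠ 0 := by rw [eω]; simp; exact sc.ne'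
  have cim : ∀ q : ℂ, q.im ≠ 0 → ((starRingEnd ℂ) q).im ≠ 0 := by
    intro q hq; simpa using hq
  refine ⟨?_, ?_, ?_, ?_⟩
  · exact core (A 1) E (hz 1) hE.2.2.2.1 hne hE.2.1 (hE.2.2.2.2 1 0)
      (by rw [h12]; exact hE.2.2.2.2 2) ρ σ iρ iσ hρ1 hρ2 hσ1 hσ2 x y u v nxy nuv
      (by rw [h12]; simp [hxy, a2, b1, b2])
  · exact core (A 2) E (hz 2) hE.2.2.2.1 hne hE.2.1 (hE.2.2.2.2 2 0)
      (by rw [h21]; exact hE.2.2.2.2 1) _ _ (cim _ iρ) (cim _ iσ)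
      (cj 1 2 1 _ h12 hρ1) (cj 1 2 2 _ h12 hρ2) (cj 1 2 3 _ h12 hσ1) (cj 1 2 4 _ h12 hσ2)
      x y u v nxy nuv (by rw [h21]; simp [hxy, a2, b1, b2])
  · exact core (A 3) E (hz 3) hE.2.2.2.1 hne hE.2.1 (hE.2.2.2.2 3 0)
      (by rw [h34]; exact hE.2.2.2.2 4) τ ω iτ iω hτ1 hτ2 hω1 hω2 x y u v nxy nuv
      (by rw [h34]; simp [huv, a3, a4, b4])
  · exact core (A 4) E (hz 4) hE.2.2.2.1 hne hE.2.1 (hE.2.2.2.2 4 0)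
      (by rw [h43]; exact hE.2.2.2.2 3) _ _ (cim _ iτ) (cim _ iω)
      (cj 3 4 1 _ h34 hτ1) (cj 3 4 2 _ h34 hτ2) (cj 3 4 3 _ h34 hω1) (cj 3 4 4 _ h34 hω2)
      x y u v nxy nuv (by rw [h43]; simp [huv, a3, a4, b4])
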